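/- Let d ≥ 1 be an integer. For every tree T with maximum degree at most 2 and every T-partition (B_u : u ∈ V(T)) of the complete tree X_{3,d}, there exists a node u ∈ V(T) with |B_u| ≥ |V(X_{3,d})| / (2d + 1). -/

import Mathlib

open SimpleGraph

/-- The maximum degree of a finite simple graph `G`:
the supremum of the numbers of neighbours of its vertices. -/
noncomputable def maxDeg {V : Type*} [Fintype V] (G : SimpleGraph V) : ℕ :=
  sSup (Set.range fun v => (G.neighborSet v).ncard)

/-- `B` is a `T`-partition of the graph `G`: the tree `T` indexes a partition
`(B x : x ∈ V(T))` of `V(G)` such that for every edge `vw` of `G`, if `v ∈ B x` and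
`w ∈ B y` then `x = y` or `xy ∈ E(T)`. -/
structure IsTreePartition {V ι : Type*} (G : SimpleGraph V) (T : SimpleGraph ι)
    (B : ι → Set V) : Prop where
  /-- `T` is a tree. -/
  isTree : T.IsTree
  /-- the parts are nonempty -/
  part_nonempty : ∀ x, (B x).Nonempty
  /-- every vertex of `G` lies in exactly one part -/
  part_existsUnique : ∀ v, ∃! x, v ∈ B x
  /-- parts containing adjacent vertices are equal or adjacent in `T` -/
  part_adj : ∀ ⦃v w x y⦄, G.Adj v w → v ∈ B x → w ∈ B y → x = y ∨ T.Adj x y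

/-- `B` is a tree-decomposition of the graph `G` over the tree `T`:
every edge of `G` has both ends in a common bag, and for each vertex `v` of `G`
the set of nodes whose bag contains `v` induces a non-empty subtree of `T`. -/
structure IsTreeDecomp {V ι : Type*} (G : SimpleGraph V) (T : SimpleGraph ι)
    (B : ι → Set V) : Prop where
  /-- `T` is a tree. -/
  isTree : T.IsTree
  /-- every edge of `G` lies in some bag -/
  edge_mem : ∀ ⦃u v⦄, G.Adj u v → ∃ x, u ∈ B x ∧ v ∈ B x
  /-- the bags containing a given vertex induce a non-empty subtree -/
  subtree : ∀ v, (T.induce {x | v ∈ B x}).Connected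

/-- The treewidth of a finite graph: the minimum, over tree-decompositions,
of the maximum bag size minus one. -/
noncomputable def treewidth {V : Type} [Fintype V] (G : SimpleGraph V) : ℕ :=
  sInf {k | ∃ (ι : Type) (_ : Fintype ι) (T : SimpleGraph ι) (B : ι → Set V),
    IsTreeDecomp G T B ∧ ∀ x, (B x).ncard ≤ k + 1}

/-- The tree-partition-width of a finite graph: the minimum width of a tree-partition. -/
noncomputable def tpw {V : Type} [Fintype V] (G : SimpleGraph V) : ℕ :=
  sInf {k | ∃ (ι : Type) (_ : Fintype ι) (T : SimpleGraph ι) (B : ι → Set V),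
    IsTreePartition G T B ∧ ∀ x, (B x).ncard ≤ k}

/-- `X` is the complete tree `X_{Δ,d}` with root `r`: a tree in which every leaf
(vertex of degree `1`) is at distance exactly `d` from `r` and every non-leaf vertex has
degree `Δ`. -/
def IsCompleteTree {κ : Type*} [Fintype κ] (Δ d : ℕ) (X : SimpleGraph κ) (r : κ) : Prop :=
  X.IsTree ∧
  (∀ v, (X.neighborSet v).ncard = 1 → X.dist r v = d) ∧
  (∀ v, (X.neighborSet v).ncard ≠ 1 → (X.neighborSet v).ncard = Δ)

theorem SimpleGraph.Connected.exists_adj_dist_eq {V : Type*} {G : SimpleGraph V}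
    (hG : G.Connected) {a y : V} {k : ℕ} (h : G.dist a y = k + 1) :
    ∃ z, G.Adj z y ∧ G.dist a z = k := by
  rw [dist_comm] at h
  obtain ⟨p, hp⟩ := hG.exists_walk_length_eq_dist y a
  cases p with
  | nil => simp at h
  | @cons _ z _ hadj q =>
    refine ⟨z, hadj.symm, ?_⟩
    have h1 : G.dist z a ≤ q.length := dist_le q
    have h2 : G.dist y a ≤ G.dist y z + G.dist z a := hG.dist_triangle
    have h3 : G.dist y z = 1 := dist_eq_one_iff_adj.mpr hadj
    rw [Walk.length_cons] at hp
    rw [dist_comm]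
    omega

/-- In a connected graph of maximum degree at most `2`, every sphere has at most `2` elements. -/
theorem card_sphere_le_two {V : Type*} [Fintype V] [DecidableEq V] {G : SimpleGraph V}
    (hG : G.Connected) (hdeg : ∀ x, (G.neighborSet x).ncard ≤ 2) (a : V) (k : ℕ) :
    (Finset.univ.filter fun x => G.dist a x = k + 1).card ≤ 2 := by
  induction k with
  | zero =>
    refine le_trans ?_ (hdeg a)
    rw [← Set.ncard_coe_finset]
    refine Set.ncard_le_ncard ?_ (Set.toFinite _)
    intro x hx
    simpa [dist_eq_one_iff_adj] using hx
  | succ k ih =>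
    refine le_trans ?_ ih
    have hpar : ∀ y, G.dist a y = k + 1 + 1 → ∃ z, G.Adj z y ∧ G.dist a z = k + 1 :=
      fun y hy => hG.exists_adj_dist_eq hy
    choose! f hf using hpar
    refine Finset.card_le_card_of_injOn f ?_ ?_
    · intro y hy
      simpa using (hf y (by simpa using hy)).2
    · intro y hy y' hy' heq
      have hy1 : G.dist a y = k + 1 + 1 := by simpa using hy
      have hy2 : G.dist a y' = k + 1 + 1 := by simpa using hy'
      obtain ⟨w, hw, hwd⟩ := hG.exists_adj_dist_eq (hf y hy1).2
      by_contra hne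
      have hwy : w ≠ y := by rintro rfl; omega
      have hwy' : w ≠ y' := by rintro rfl; omega
      have hsub : (({w, y, y'} : Finset V) : Set V) ⊆ G.neighborSet (f y) := by
        intro x hx
        simp only [Finset.coe_insert, Finset.coe_singleton, Set.mem_insert_iff,
          Set.mem_singleton_iff] at hx
        rcases hx with rfl | rfl | rfl
        · exact hw.symm
        · exact (hf x hy1).1
        · rw [heq]
          exact (hf x hy2).1
      have h3 := Set.ncard_le_ncard hsub (Set.toFinite _)
      rw [Set.ncard_coe_finset, Finset.card_eq_three.mpr ⟨w, y, y', hwy, hwy', hne, rfl⟩] at h3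
      have := hdeg (f y)
      omega

theorem card_le_of_dist_le {V : Type*} [Fintype V] {G : SimpleGraph V}
    (hG : G.Connected) (hdeg : ∀ x, (G.neighborSet x).ncard ≤ 2) (a : V) (d : ℕ)
    (hd : ∀ x, G.dist a x ≤ d) : Fintype.card V ≤ 2 * d + 1 := by
  classical
  have h := Finset.card_eq_sum_card_fiberwise (s := (Finset.univ : Finset V))
    (f := fun x => G.dist a x) (t := Finset.range (d + 1))
    (fun x _ => by simpa using Nat.lt_succ_of_le (hd x))
  rw [Finset.card_univ, Finset.sum_range_succ'] at h
  have h0 : (Finset.univ.filter fun x => G.dist a x = 0).card ≤ 1 := by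
    refine Finset.card_le_one.mpr fun x hx y hy => ?_
    simp only [Finset.mem_filter, Finset.mem_univ, true_and, hG.dist_eq_zero_iff] at hx hy
    rw [← hx, ← hy]
  have h1 : ∑ k ∈ Finset.range d, (Finset.univ.filter fun x => G.dist a x = k + 1).card
      ≤ ∑ _k ∈ Finset.range d, 2 :=
    Finset.sum_le_sum fun k _ => card_sphere_le_two hG hdeg a k
  simp only [Finset.sum_const, Finset.card_range, smul_eq_mul] at h1
  omega

/-- A vertex of a tree at maximum distance from `r` has at most one neighbour. -/
theorem SimpleGraph.IsTree.ncard_neighborSet_le_one {V : Type*} {G : SimpleGraph V}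
    (hG : G.IsTree) {r v : V} (hmax : ∀ w, G.dist r w ≤ G.dist r v) :
    (G.neighborSet v).ncard ≤ 1 := by
  classical
  obtain ⟨p, hp, hlen⟩ := hG.connected.exists_path_of_dist r v
  have hsub : G.neighborSet v ⊆ {p.penultimate} := by
    intro w hw
    rw [mem_neighborSet] at hw
    by_cases hmem : w ∈ p.support
    · have hq := hp.takeUntil hmem
      have hv : v ∉ (p.takeUntil w hmem).support :=
        Walk.endpoint_notMem_support_takeUntil hp hmem hw.ne
      have heq := hG.existsUnique_path r v |>.unique hp (hq.concat hv hw.symm)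
      rw [heq]
      simp
    · have hq := hp.concat hmem hw
      obtain ⟨q', hq', hlen'⟩ := hG.connected.exists_path_of_dist r w
      have heq := hG.existsUnique_path r w |>.unique hq hq'
      have := hmax w
      rw [← hlen', ← heq, Walk.length_concat] at this
      omega
  exact (Set.ncard_le_ncard hsub).trans (Set.ncard_singleton _).le

theorem IsCompleteTree.dist_le {κ : Type*} [Fintype κ] {d : ℕ} {X : SimpleGraph κ} {r : κ}
    (hX : IsCompleteTree 3 d X r) (w : κ) : X.dist r w ≤ d := by
  obtain ⟨v, -, hv⟩ := Finset.exists_max_image Finset.univ (X.dist r) ⟨r, Finset.mem_univ r⟩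
  have hle := hX.1.ncard_neighborSet_le_one fun w => hv w (Finset.mem_univ w)
  have h1 : (X.neighborSet v).ncard = 1 := by
    by_contra hne
    have := hX.2.2 v hne
    omega
  exact (hv w (Finset.mem_univ w)).trans (hX.2.1 v h1).le

theorem SimpleGraph.Walk.dist_map_le_length {V ι : Type*} {G : SimpleGraph V}
    {T : SimpleGraph ι} (hT : T.Connected) {f : V → ι}
    (hf : ∀ ⦃v w⦄, G.Adj v w → f v = f w ∨ T.Adj (f v) (f w)) {v w : V} (p : G.Walk v w) :
    T.dist (f v) (f w) ≤ p.length := by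
  induction p with
  | nil => simp
  | @cons a b c h q ih =>
    rw [Walk.length_cons]
    rcases hf h with heq | hadj
    · rw [heq]
      omega
    · have h1 : T.dist (f a) (f c) ≤ T.dist (f a) (f b) + T.dist (f b) (f c) :=
        hT.dist_triangle
      rw [dist_eq_one_iff_adj.mpr hadj] at h1
      omega

/-- Let `d ≥ 1` be an integer. For every tree `T` with maximum degree
at most `2` and every `T`-partition `(B u : u ∈ V(T))` of the complete tree `X_{3,d}`,
there exists a node `u ∈ V(T)` with `|B u| ≥ |V(X_{3,d})| / (2d + 1)`. -/
theorem exists_large_part_of_path_treePartition (d : ℕ) (hd : 1 ≤ d)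
    {κ ι : Type} [Fintype κ] [Fintype ι]
    (X : SimpleGraph κ) (r : κ) (hX : IsCompleteTree 3 d X r)
    (T : SimpleGraph ι) (B : ι → Set κ)
    (hdeg : ∀ x, (T.neighborSet x).ncard ≤ 2)
    (hB : IsTreePartition X T B) :
    ∃ u, (Fintype.card κ : ℝ) / (2 * d + 1) ≤ ((B u).ncard : ℝ) := by
  choose f hf huniq using hB.part_existsUnique
  have hfib : ∀ u v, v ∈ B u ↔ f v = u := fun u v =>
    ⟨fun h => (huniq v u h).symm, fun h => h ▸ hf v⟩
  have hcard : Fintype.card ι ≤ 2 * d + 1 := by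
    refine card_le_of_dist_le hB.isTree.connected hdeg (f r) d fun x => ?_
    obtain ⟨v, hv⟩ := hB.part_nonempty x
    obtain ⟨p, hp⟩ := hX.1.connected.exists_walk_length_eq_dist r v
    rw [← (hfib x v).mp hv]
    refine (p.dist_map_le_length hB.isTree.connected
      fun a b hab => hB.part_adj hab (hf a) (hf b)).trans ?_
    rw [hp]
    exact hX.dist_le v
  classical
  have hsum : Fintype.card κ = ∑ u, (B u).ncard := by
    rw [← Finset.card_univ, Finset.card_eq_sum_card_fiberwise (f := f) (t := Finset.univ)
      fun _ _ => Finset.mem_coe.mpr (Finset.mem_univ _)]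
    refine Finset.sum_congr rfl fun u _ => ?_
    rw [← Set.ncard_coe_finset]
    congr 1
    ext v
    simp [hfib]
  obtain ⟨u, -, hu⟩ := Finset.exists_max_image Finset.univ (fun u => (B u).ncard)
    ⟨f r, Finset.mem_univ _⟩
  refine ⟨u, ?_⟩
  have hle : Fintype.card κ ≤ (B u).ncard * (2 * d + 1) := by
    rw [hsum]
    calc ∑ x, (B x).ncard ≤ Fintype.card ι * (B u).ncard := by
          simpa using Finset.sum_le_card_nsmul Finset.univ _ _ hu
      _ ≤ (2 * d + 1) * (B u).ncard := Nat.mul_le_mul_right _ hcard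
      _ = (B u).ncard * (2 * d + 1) := mul_comm _ _
  rw [div_le_iff₀ (by positivity)]
  exact_mod_cast hle
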